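/- Let k be a field complete with respect to a nonarchimedean absolute value |·|, let 0 < c₁ < c₂, and let f = Σ_{m∈ℤ} f_m z^m and g = Σ_{m∈ℤ} g_m z^m be Laurent series, converging at every point of the open annulus A(c₁,c₂), with dominant exponents m and n respectively on A(c₁,c₂). Suppose |f(z)| = |g(z)| for every z ∈ A(c₁,c₂), and suppose there exist z₁, z₂ ∈ A(c₁,c₂) with |z₁| ≠ |z₂|. Then m = n and |f_m| = |g_n|. -/

import Mathlib

theorem norm_sum_lt_of_forall_lt {ι M : Type*} [SeminormedAddCommGroup M] [IsUltrametricDist M]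
    {s : Finset ι} {a : ι → M} {C : ℝ} (hC : 0 < C) (h : ∀ i ∈ s, ‖a i‖ < C) :
    ‖∑ i ∈ s, a i‖ < C :=
  Finset.sum_induction a (‖·‖ < C)
    (fun x y hx hy => (IsUltrametricDist.norm_add_le_max x y).trans_lt (max_lt hx hy))
    (by simpa using hC) h

/-- In an ultrametric group, the norm of a sum with a strictly dominant term is the norm of
that term. -/
theorem HasSum.norm_eq_of_forall_ne_norm_lt {ι M : Type*} [SeminormedAddCommGroup M]
    [IsUltrametricDist M] {a : ι → M} {x : M} (hx : HasSum a x) {m : ι} (hm : 0 < ‖a m‖)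
    (h : ∀ i ≠ m, ‖a i‖ < ‖a m‖) : ‖x‖ = ‖a m‖ := by
  classical
  have hx' : Filter.Tendsto (fun s : Finset ι => ‖∑ i ∈ s, a i‖) Filter.atTop (nhds ‖x‖) :=
    Filter.Tendsto.norm hx
  refine tendsto_nhds_unique hx' (tendsto_const_nhds.congr' ?_)
  filter_upwards [Filter.eventually_ge_atTop {m}] with s hs
  have hlt : ‖∑ i ∈ s.erase m, a i‖ < ‖a m‖ :=
    norm_sum_lt_of_forall_lt hm fun i hi => h i (Finset.ne_of_mem_erase hi)
  rw [← Finset.add_sum_erase s a (hs (Finset.mem_singleton_self m)),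
    IsUltrametricDist.norm_add_eq_max_of_norm_ne_norm hlt.ne', max_eq_left hlt.le]

/-- The absolute value of a Laurent series at a point whose radius has a strictly dominant
exponent `m` is that of the term of exponent `m`. -/
theorem norm_tsum_mul_zpow_eq_of_dominant {k : Type*} [NormedField k] [IsUltrametricDist k]
    {f : ℤ → k} {m : ℤ} {z : k} (hz : Summable fun i : ℤ => f i * z ^ i)
    (h : ∀ i : ℤ, i ≠ m → ‖f i‖ * ‖z‖ ^ i < ‖f m‖ * ‖z‖ ^ m) :
    ‖∑' i : ℤ, f i * z ^ i‖ = ‖f m‖ * ‖z‖ ^ m := by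
  have h' : ∀ i ≠ m, ‖f i * z ^ i‖ < ‖f m * z ^ m‖ := by simpa using h
  have hm : 0 < ‖f m * z ^ m‖ := (norm_nonneg _).trans_lt (h' (m + 1) (by simp))
  simpa using hz.hasSum.norm_eq_of_forall_ne_norm_lt hm h'

/-- A monomial function `r ↦ a * r ^ m` with `a ≠ 0` is determined by its values at two positive
points. -/
theorem eq_and_eq_of_mul_zpow_eq {a b r s : ℝ} {m n : ℤ} (ha : a ≠ 0) (hr : 0 < r) (hs : 0 < s)
    (hrs : r ≠ s) (h₁ : a * r ^ m = b * r ^ n) (h₂ : a * s ^ m = b * s ^ n) :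
    m = n ∧ a = b := by
  have hr' : a * r ^ (m - n) = b := by
    rw [zpow_sub₀ hr.ne', ← mul_div_assoc, h₁, mul_div_cancel_right₀ _ (zpow_pos hr n).ne']
  have hs' : a * s ^ (m - n) = b := by
    rw [zpow_sub₀ hs.ne', ← mul_div_assoc, h₂, mul_div_cancel_right₀ _ (zpow_pos hs n).ne']
  have hpow : r ^ (m - n) = s ^ (m - n) := mul_left_cancel₀ ha (hr'.trans hs'.symm)
  have hratio : (r / s) ^ (m - n) = 1 := by
    rw [div_zpow, hpow, div_self (zpow_pos hs _).ne']
  have hmn : m - n = 0 :=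
    (zpow_eq_one_iff_right₀ (div_pos hr hs).le (by rwa [Ne, div_eq_one_iff_eq hs.ne'])).1 hratio
  exact ⟨sub_eq_zero.1 hmn, by simpa [hmn] using hr'⟩


/-- Two Laurent series converging on the open annulus `A(c₁,c₂)`, with dominant exponents
`m` and `n` respectively, whose absolute values agree on the annulus (assumed to contain
points of at least two distinct radii) satisfy `m = n` and `|f_m| = |g_n|`. -/
theorem stmt_4 {k : Type*} [NormedField k] [CompleteSpace k] [IsUltrametricDist k]
    (c₁ c₂ : ℝ) (hc₁ : 0 < c₁) (hc : c₁ < c₂) (f g : ℤ → k) (m n : ℤ)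
    (hdomf : ∀ i : ℤ, i ≠ m → ∀ r ∈ Set.Ioo c₁ c₂, ‖f i‖ * r ^ i < ‖f m‖ * r ^ m)
    (hdomg : ∀ i : ℤ, i ≠ n → ∀ r ∈ Set.Ioo c₁ c₂, ‖g i‖ * r ^ i < ‖g n‖ * r ^ n)
    (hconvf : ∀ z : k, ‖z‖ ∈ Set.Ioo c₁ c₂ → Summable fun i : ℤ => f i * z ^ i)
    (hconvg : ∀ z : k, ‖z‖ ∈ Set.Ioo c₁ c₂ → Summable fun i : ℤ => g i * z ^ i)
    (heq : ∀ z : k, ‖z‖ ∈ Set.Ioo c₁ c₂ →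
      ‖∑' i : ℤ, f i * z ^ i‖ = ‖∑' i : ℤ, g i * z ^ i‖)
    (z₁ z₂ : k) (hz₁ : ‖z₁‖ ∈ Set.Ioo c₁ c₂) (hz₂ : ‖z₂‖ ∈ Set.Ioo c₁ c₂)
    (hne : ‖z₁‖ ≠ ‖z₂‖) :
    m = n ∧ ‖f m‖ = ‖g n‖ := by
  have key : ∀ z : k, ‖z‖ ∈ Set.Ioo c₁ c₂ → ‖f m‖ * ‖z‖ ^ m = ‖g n‖ * ‖z‖ ^ n := fun z hz => by
    rw [← norm_tsum_mul_zpow_eq_of_dominant (hconvf z hz) fun i hi => hdomf i hi _ hz, heq z hz,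
      norm_tsum_mul_zpow_eq_of_dominant (hconvg z hz) fun i hi => hdomg i hi _ hz]
  have hpos₁ : 0 < ‖z₁‖ := hc₁.trans hz₁.1
  have hfm : ‖f m‖ ≠ 0 := fun h0 => by
    have hlt := hdomf (m + 1) (by simp) _ hz₁
    rw [h0, zero_mul] at hlt
    exact hlt.not_ge (by positivity)
  exact eq_and_eq_of_mul_zpow_eq hfm hpos₁ (hc₁.trans hz₂.1) hne (key z₁ hz₁) (key z₂ hz₂)
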